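/- Let F_7 denote the Fano plane, viewed as the 3-uniform hypergraph on vertex set {1,2,...,7} with the seven edges {1,2,4}, {2,3,5}, {3,4,6}, {4,5,7}, {5,6,1}, {6,7,2}, {7,1,3}. Then FDT(F_7) = 7/3. -/

import Mathlib

/-- `T` is a transversal of the hypergraph with edge family `E`: it meets every edge. -/
def IsTransversal (E : Multiset (Finset ℕ)) (T : Finset ℕ) : Prop :=
  ∀ e ∈ E, ∃ v ∈ e, v ∈ T

/-- `r_F`: the maximum, over the vertices in `Vs`, of the number of members of `F`
containing the vertex. -/
def maxAppear (Vs : Finset ℕ) (F : Multiset (Finset ℕ)) : ℕ :=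
  Vs.sup fun v => Multiset.countP (fun S => v ∈ S) F

/-- The fractional disjoint transversal number of the hypergraph with vertex set `Vs`
and edge family `E`. -/
noncomputable def FDT (Vs : Finset ℕ) (E : Multiset (Finset ℕ)) : ℝ :=
  sSup { r : ℝ | ∃ F : Multiset (Finset ℕ), F ≠ 0 ∧
      (∀ T ∈ F, T ⊆ Vs ∧ IsTransversal E T) ∧
      r = (Multiset.card F : ℝ) / (maxAppear Vs F : ℝ) }

/-- The seven lines of the Fano plane on the vertex set `{1, ..., 7}`. -/
def fanoEdges : Multiset (Finset ℕ) :=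
  {{1, 2, 4}, {2, 3, 5}, {3, 4, 6}, {4, 5, 7}, {5, 6, 1}, {6, 7, 2}, {7, 1, 3}}

instance instDecTransversal (E : Multiset (Finset ℕ)) (T : Finset ℕ) :
    Decidable (IsTransversal E T) :=
  inferInstanceAs (Decidable (∀ e ∈ E, ∃ v ∈ e, v ∈ T))

set_option maxRecDepth 100000 in
lemma three_le_card : ∀ T ∈ (Finset.Icc 1 7).powerset, IsTransversal fanoEdges T → 3 ≤ T.card := by
  decide +kernel

lemma sum_count (F : Multiset (Finset ℕ)) :
    (∀ T ∈ F, T ⊆ Finset.Icc 1 7 ∧ IsTransversal fanoEdges T) →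
    3 * Multiset.card F ≤ ∑ v ∈ Finset.Icc 1 7, Multiset.countP (fun S => v ∈ S) F := by
  induction F using Multiset.induction_on with
  | empty => simp
  | cons T F ih =>
    intro h
    have h1 := ih (fun S hS => h S (Multiset.mem_cons_of_mem hS))
    obtain ⟨hT, hT2⟩ := h T (Multiset.mem_cons_self T F)
    have h2 := three_le_card T (Finset.mem_powerset.2 hT) hT2
    simp only [Multiset.countP_cons, Multiset.card_cons, Finset.sum_add_distrib]
    rw [← Finset.card_filter, Finset.filter_mem_eq_inter, Finset.inter_eq_right.2 hT]
    omega

lemma card_le (F : Multiset (Finset ℕ))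
    (h : ∀ T ∈ F, T ⊆ Finset.Icc 1 7 ∧ IsTransversal fanoEdges T) :
    3 * Multiset.card F ≤ 7 * maxAppear (Finset.Icc 1 7) F := by
  refine (sum_count F h).trans ?_
  have : ∀ v ∈ Finset.Icc 1 7, Multiset.countP (fun S => v ∈ S) F
      ≤ maxAppear (Finset.Icc 1 7) F := fun v hv =>
    Finset.le_sup (f := fun v => Multiset.countP (fun S => v ∈ S) F) hv
  simpa using Finset.sum_le_card_nsmul _ _ _ this

set_option maxRecDepth 100000 in
lemma fano_self : ∀ T ∈ fanoEdges, T ⊆ Finset.Icc 1 7 ∧ IsTransversal fanoEdges T := by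
  decide +kernel

lemma fano_max : maxAppear (Finset.Icc 1 7) fanoEdges = 3 := by
  decide +kernel

theorem stmt17 : FDT (Finset.Icc 1 7) fanoEdges = 7 / 3 := by
  refine IsGreatest.csSup_eq ⟨⟨fanoEdges, ?_, fano_self, ?_⟩, ?_⟩
  · simp [fanoEdges]
  · rw [fano_max]; simp [fanoEdges]
  · rintro r ⟨F, -, hF, rfl⟩
    have h := card_le F hF
    have h' : 3 * (Multiset.card F : ℝ) ≤ 7 * (maxAppear (Finset.Icc 1 7) F : ℝ) := by
      exact_mod_cast h
    refine div_le_of_le_mul₀ (by positivity) (by norm_num) ?_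
    linarith
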